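/- Let D = (V+r, E) be a rooted digraph in which the vertex t ∈ V is a sink (it is not left by any edge). Then F ⊆ E is a maximal flame of D if and only if F is the disjoint union of a maximal flame of D − t and a base of the gammoid G_D(t). -/

import Mathlib

/- Common setup: a rooted digraph `D = (V+r, E)` is modelled as a finite
vertex type `α` (whose elements are `V ∪ {r}`), a finite edge type `E`
(allowing parallel edges, i.e. a multigraph) and maps `tail head : E → α`.
Subgraphs / edge subsets are sets `F : Set E`; the whole digraph `D`
corresponds to the edge set `Set.univ`.  "`v ∈ V`" is rendered as `v ≠ r`,
and a vertex subset `X ⊆ V` as `X : Set α` with `r ∉ X`. -/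

/-- In-degree of the vertex `v` in the digraph with edge set `F`. -/
noncomputable def inDeg {α E : Type*} (head : E → α) (F : Set E) (v : α) : ℕ :=
  {e ∈ F | head e = v}.ncard

/-- `ϱ_F(X)`: the number of edges of `F` entering the vertex set `X`
(tail outside `X`, head in `X`). -/
noncomputable def rho {α E : Type*} (tail head : E → α) (F : Set E) (X : Set α) : ℕ :=
  {e ∈ F | tail e ∉ X ∧ head e ∈ X}.ncard

/-- `p` is a directed path from `r` to `v` using edges of `F`:
a nonempty list of consecutive edges, starting at `r`, ending at `v`, and
visiting pairwise distinct vertices. -/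
def IsRVPath {α E : Type*} (tail head : E → α) (F : Set E) (r v : α) (p : List E) : Prop :=
  (∀ e ∈ p, e ∈ F) ∧
  List.Chain' (fun e f => head e = tail f) p ∧
  (p.map tail).Nodup ∧ (∀ e ∈ p, tail e ≠ v) ∧
  (∃ e, p.head? = some e ∧ tail e = r) ∧
  (∃ e, p.getLast? = some e ∧ head e = v)

/-- There exist `n` pairwise edge-disjoint directed paths from `r` to `v`
in the edge set `F`. -/
def HasEDPaths {α E : Type*} (tail head : E → α) (F : Set E) (r v : α) (n : ℕ) : Prop :=
  ∃ P : Fin n → List E, (∀ i, IsRVPath tail head F r v (P i)) ∧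
    ∀ i j, i ≠ j → ∀ e, e ∈ P i → e ∉ P j

/-- `λ_F(r,v)`: the local edge-connectivity from `r` to `v`, i.e. the maximum
number of pairwise edge-disjoint directed paths from `r` to `v` in `F`. -/
noncomputable def lam {α E : Type*} (tail head : E → α) (F : Set E) (r v : α) : ℕ :=
  sSup {n | HasEDPaths tail head F r v n}

/-- `X` is a `v`-tight vertex set in the digraph with edge set `F` and root `r`:
`X ⊆ V` (i.e. `r ∉ X`), `v ∈ X` and `ϱ_F(X) = λ_F(r,v)`. -/
def Tight {α E : Type*} (tail head : E → α) (F : Set E) (r v : α) (X : Set α) : Prop :=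
  v ∈ X ∧ r ∉ X ∧ rho tail head F X = lam tail head F r v

/-- The digraph with edge set `F` is a flame with root `r`:
`λ_F(r,v) = ϱ_F(v)` for every `v ∈ V`. -/
def IsFlame {α E : Type*} (tail head : E → α) (F : Set E) (r : α) : Prop :=
  ∀ v, v ≠ r → lam tail head F r v = inDeg head F v

/-- `F` is a maximal flame within the ambient edge set `A`:
`λ_A(r,v) = λ_F(r,v) = ϱ_F(v)` for every `v ∈ V`. -/
def IsMaxFlameIn {α E : Type*} (tail head : E → α) (A : Set E) (r : α) (F : Set E) : Prop :=
  F ⊆ A ∧ ∀ v, v ≠ r →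
    lam tail head A r v = lam tail head F r v ∧
    lam tail head F r v = inDeg head F v

/-- A closed directed walk in `F` with pairwise distinct edges.  (If every
vertex is entered by at most one edge of `F`, the existence of such a walk is
equivalent to the existence of an undirected cycle in `F`.) -/
def IsDicycle {α E : Type*} (tail head : E → α) (F : Set E) (p : List E) : Prop :=
  p.Nodup ∧ (∀ e ∈ p, e ∈ F) ∧
  List.Chain' (fun e f => head e = tail f) p ∧
  (∃ e f, p.head? = some e ∧ p.getLast? = some f ∧ head f = tail e)

/-- `B` is a branching: every vertex is entered by at most one edge of `B` and,
disregarding edge directions, `B` contains no cycle (under the in-degree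
condition this is equivalent to containing no directed cycle). -/
def IsBranching {α E : Type*} (tail head : E → α) (B : Set E) : Prop :=
  (∀ v, inDeg head B v ≤ 1) ∧ ∀ p : List E, ¬ IsDicycle tail head B p

/-- The head-set of an edge set `B`: the vertices entered by an edge of `B`. -/
def headSet {α E : Type*} (head : E → α) (B : Set E) : Set α := {v | ∃ e ∈ B, head e = v}

/-- Independence in the gammoid `G_D(v)` (with `D` the whole digraph, edge set
`Set.univ`): `X ⊆ in_D(v)` is independent if there are `|X|` pairwise
edge-disjoint directed paths from `r` to `v` in `D` whose set of last edges is
exactly `X`. -/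
def GammoidIndep {α E : Type*} (tail head : E → α) (r v : α) (X : Set E) : Prop :=
  ∃ P : Fin X.ncard → List E,
    (∀ i, IsRVPath tail head Set.univ r v (P i)) ∧
    (∀ i j, i ≠ j → ∀ e, e ∈ P i → e ∉ P j) ∧
    (∀ e, e ∈ X ↔ ∃ i, (P i).getLast? = some e)

section Cuts

variable {α E : Type*} {tail head : E → α} {F G : Set E} {r v t : α} {p : List E}

lemma IsRVPath.of_forall_mem (h : IsRVPath tail head F r v p) (hG : ∀ e ∈ p, e ∈ G) :
    IsRVPath tail head G r v p :=
  ⟨hG, h.2⟩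

lemma rho_mono [Finite E] (h : F ⊆ G) (X : Set α) : rho tail head F X ≤ rho tail head G X :=
  Set.ncard_le_ncard fun _ he => ⟨h he.1, he.2⟩

lemma rho_inter_add_rho_union_le [Finite E] (F : Set E) (X Y : Set α) :
    rho tail head F (X ∩ Y) + rho tail head F (X ∪ Y) ≤
      rho tail head F X + rho tail head F Y := by
  unfold rho
  rw [← Set.ncard_union_add_ncard_inter, ← Set.ncard_union_add_ncard_inter {e ∈ F | tail e ∉ X ∧ _}]
  refine add_le_add (Set.ncard_le_ncard ?_) (Set.ncard_le_ncard ?_) <;>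
  · intro e he
    simp only [Set.mem_union, Set.mem_inter_iff, Set.mem_ofPred_eq] at he ⊢
    tauto

lemma rho_singleton_le_inDeg [Finite E] (F : Set E) (v : α) :
    rho tail head F {v} ≤ inDeg head F v :=
  Set.ncard_le_ncard fun _ he => ⟨he.1, he.2.2⟩

/-- A walk that starts outside `X` and ends in `X` has an edge entering `X`. -/
lemma exists_mem_entering {X : Set α} :
    ∀ {p : List E}, List.IsChain (fun e f => head e = tail f) p →
      (∃ e, p.head? = some e ∧ tail e ∉ X) → (∃ e, p.getLast? = some e ∧ head e ∈ X) →
      ∃ e ∈ p, tail e ∉ X ∧ head e ∈ X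
  | [], _, h, _ => by simp at h
  | [e], _, h, h' => by simpa using And.intro h h'
  | e :: f :: p, hc, h, h' => by
    by_cases hX : head e ∈ X
    · exact ⟨e, by simp, by simpa using h, hX⟩
    · rw [List.isChain_cons_cons] at hc
      obtain ⟨g, hg, hgX⟩ := exists_mem_entering hc.2 ⟨f, rfl, hc.1 ▸ hX⟩ (by simpa using h')
      exact ⟨g, List.mem_cons_of_mem _ hg, hgX⟩

lemma HasEDPaths.le_rho [Finite E] {n : ℕ} (h : HasEDPaths tail head F r v n) {X : Set α}
    (hv : v ∈ X) (hr : r ∉ X) : n ≤ rho tail head F X := by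
  obtain ⟨P, hP, hdisj⟩ := h
  have key : ∀ i, ∃ e ∈ P i, tail e ∉ X ∧ head e ∈ X := fun i => by
    obtain ⟨-, hc, -, -, ⟨e, he, her⟩, f, hf, hfv⟩ := hP i
    exact exists_mem_entering hc ⟨e, he, her ▸ hr⟩ ⟨f, hf, hfv ▸ hv⟩
  choose c hc hcX using key
  have hinj : Function.Injective c := fun i j hij => by
    by_contra hne
    exact hdisj i j hne (c i) (hc i) (hij ▸ hc j)
  calc n = (Set.range c).ncard := by
        rw [← Set.image_univ, Set.ncard_image_of_injective _ hinj, Set.ncard_univ, Nat.card_fin]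
    _ ≤ _ := Set.ncard_le_ncard (by rintro _ ⟨i, rfl⟩; exact ⟨(hP i).1 _ (hc i), hcX i⟩)

/-- If every cut separating `v` from `r` has at least `k + 1` edges, then some path from `r` to `v`
can be removed so that every such cut still has at least `k` edges. -/
lemma exists_path_le_rho_diff [Finite α] [Finite E] (hv : v ≠ r) {k : ℕ}
    (h : ∀ X : Set α, v ∈ X → r ∉ X → k + 1 ≤ rho tail head F X) :
    ∃ p, IsRVPath tail head F r v p ∧
      ∀ X : Set α, v ∈ X → r ∉ X → k ≤ rho tail head (F \ {e | e ∈ p}) X := by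
  -- `R` is the vertex set of a subgraph grown from `r`, with edge set `T`.
  let good : Set (Set α) := {R | r ∈ R ∧ ∃ T ⊆ F, (∀ e ∈ T, tail e ∈ R ∧ head e ∈ R) ∧
    (∀ X : Set α, v ∈ X → r ∉ X → k ≤ rho tail head (F \ T) X) ∧
    ∀ u ∈ R, u = r ∨ ∃ p, IsRVPath tail head T r u p}
  have hne : good.Nonempty := ⟨{r}, rfl, ∅, by simp, by simp, fun X hvX hrX => by
    simpa using (Nat.le_succ k).trans (h X hvX hrX), fun u hu => Or.inl hu⟩
  obtain ⟨R, hR⟩ := (Set.toFinite good).exists_maximal hne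
  obtain ⟨hrR, T, hTF, hTR, hcut, hpath⟩ := hR.prop
  by_cases hvR : v ∈ R
  · obtain ⟨p, hp⟩ := (hpath v hvR).resolve_left hv
    exact ⟨p, hp.of_forall_mem fun e he => hTF (hp.1 e he), fun X hvX hrX =>
      (hcut X hvX hrX).trans (rho_mono (Set.sdiff_subset_sdiff_right hp.1) X)⟩
  exfalso
  have key : ∃ e ∈ F, tail e ∈ R ∧ head e ∉ R ∧ ∀ Y : Set α, v ∈ Y → r ∉ Y →
      rho tail head (F \ T) Y = k → ¬ (tail e ∉ Y ∧ head e ∈ Y) := by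
    let crit : Set (Set α) := {X | v ∈ X ∧ r ∉ X ∧ rho tail head (F \ T) X = k}
    rcases crit.eq_empty_or_nonempty with hC | hC
    · have hpos : 0 < rho tail head F Rᶜ := (Nat.succ_pos k).trans_le (h _ hvR (fun h => h hrR))
      obtain ⟨e, heF, het, heh⟩ := Set.nonempty_of_ncard_ne_zero hpos.ne'
      refine ⟨e, heF, by simpa using het, heh, fun Y hvY hrY hY => ?_⟩
      exact absurd (show Y ∈ crit from ⟨hvY, hrY, hY⟩) (by simp [hC])
    · obtain ⟨X, hX⟩ := (Set.toFinite crit).exists_minimal hC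
      obtain ⟨hvX, hrX, hXk⟩ := hX.prop
      have hlt : rho tail head (F \ T) X < rho tail head F (X \ R) := by
        rw [hXk]
        exact h _ ⟨hvX, hvR⟩ fun hr => hrX hr.1
      obtain ⟨e, he, he'⟩ := Set.exists_mem_notMem_of_ncard_lt_ncard hlt
      obtain ⟨heF, het, heX, heR⟩ := he
      have heT : e ∉ T := fun heT => heR (hTR e heT).2
      have hetX : tail e ∈ X := by
        by_contra hetX
        exact he' ⟨⟨heF, heT⟩, hetX, heX⟩
      refine ⟨e, heF, by_contra fun hn => het ⟨hetX, hn⟩, heR, fun Y hvY hrY hY hent => ?_⟩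
      have h1 := hcut (X ∩ Y) ⟨hvX, hvY⟩ fun hr => hrX hr.1
      have h2 := hcut (X ∪ Y) (Or.inl hvX) fun hr => hr.elim hrX hrY
      have h3 := rho_inter_add_rho_union_le (tail := tail) (head := head) (F \ T) X Y
      have hmem : X ∩ Y ∈ crit := ⟨⟨hvX, hvY⟩, fun hr => hrX hr.1, by omega⟩
      exact hent.1 (hX.le_of_le hmem Set.inter_subset_left hetX).2
  obtain ⟨e, heF, het, heh, hcrit⟩ := key
  refine heh (hR.le_of_ge (y := insert (head e) R) ?_ (Set.subset_insert _ _)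
    (Set.mem_insert _ _))
  refine ⟨Or.inr hrR, insert e T, Set.insert_subset heF hTF, ?_, ?_, ?_⟩
  · rintro f (rfl | hf)
    · exact ⟨Or.inr het, Or.inl rfl⟩
    · exact ⟨Or.inr (hTR f hf).1, Or.inr (hTR f hf).2⟩
  · intro X hvX hrX
    by_cases hent : tail e ∉ X ∧ head e ∈ X
    · have hlt : k < rho tail head (F \ T) X :=
        (hcut X hvX hrX).lt_of_ne fun heq => hcrit X hvX hrX heq.symm hent
      have hsub : {f ∈ F \ T | tail f ∉ X ∧ head f ∈ X} ⊆
          insert e {f ∈ F \ insert e T | tail f ∉ X ∧ head f ∈ X} := by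
        rintro f ⟨⟨hfF, hfT⟩, hfX⟩
        by_cases hfe : f = e
        · exact Or.inl hfe
        · exact Or.inr ⟨⟨hfF, fun hf => hf.elim hfe hfT⟩, hfX⟩
      have := (Set.ncard_le_ncard hsub).trans (Set.ncard_insert_le _ _)
      unfold rho at hlt ⊢
      omega
    · refine (hcut X hvX hrX).trans (Set.ncard_le_ncard ?_)
      rintro f ⟨⟨hfF, hfT⟩, hfX⟩
      exact ⟨⟨hfF, fun hf => hf.elim (fun hfe => hent (hfe ▸ hfX)) hfT⟩, hfX⟩
  · rintro u (rfl | hu)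
    · right
      rcases hpath _ het with hr | ⟨p, hpT, hpc, hpn, hpt, hps, f, hf, hfe⟩
      · refine ⟨[e], by simp, List.isChain_singleton e, by simp, ?_, ⟨e, rfl, hr⟩, e, rfl, rfl⟩
        simpa using fun hte : tail e = head e => heh (hte ▸ het)
      · refine ⟨p ++ [e], ?_, ?_, ?_, ?_, ?_, e, by simp, rfl⟩
        · intro g hg
          rcases List.mem_append.1 hg with hg | hg
          · exact Or.inr (hpT g hg)
          · exact Or.inl (by simpa using hg)
        · refine List.IsChain.append hpc (by simp) ?_
          simp [hf, hfe]
        · rw [List.map_append, List.nodup_append]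
          refine ⟨hpn, by simp, ?_⟩
          simpa using hpt
        · intro g hg hgh
          rcases List.mem_append.1 hg with hg | hg
          · exact heh (hgh ▸ (hTR g (hpT g hg)).1)
          · rw [List.mem_singleton.1 hg] at hgh
            exact heh (hgh ▸ het)
        · obtain ⟨g, hg, hgr⟩ := hps
          exact ⟨g, by simp [hg], hgr⟩
    · exact (hpath u hu).imp_right fun ⟨p, hp⟩ =>
        ⟨p, hp.of_forall_mem fun f hf => Or.inr (hp.1 f hf)⟩

/-- Menger's theorem for edge-disjoint directed paths. -/
theorem hasEDPaths_of_forall_le_rho [Finite α] [Finite E] (hv : v ≠ r) :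
    ∀ {k : ℕ} {F : Set E}, (∀ X : Set α, v ∈ X → r ∉ X → k ≤ rho tail head F X) →
      HasEDPaths tail head F r v k
  | 0, _, _ => ⟨Fin.elim0, fun i => i.elim0, fun i => i.elim0⟩
  | k + 1, F, h => by
    obtain ⟨p, hp, hcut⟩ := exists_path_le_rho_diff hv h
    obtain ⟨P, hP, hdisj⟩ := hasEDPaths_of_forall_le_rho hv hcut
    refine ⟨Fin.cons p P, ?_, ?_⟩
    · refine Fin.cases hp fun i => ?_
      exact (hP i).of_forall_mem fun e he => ((hP i).1 e he).1
    · refine Fin.cases (Fin.cases (by simp) fun j _ e he hej => ?_)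
        fun i => Fin.cases (fun _ e hei he => ?_) fun j hij e hei hej => ?_
      · exact ((hP j).1 e hej).2 he
      · exact ((hP i).1 e hei).2 he
      · exact hdisj i j (by simpa using hij) e hei hej

lemma bddAbove_hasEDPaths [Finite E] (F : Set E) (hv : v ≠ r) :
    BddAbove {n | HasEDPaths tail head F r v n} :=
  ⟨rho tail head F {v}, fun _ hn => hn.le_rho rfl hv.symm⟩

lemma hasEDPaths_lam [Finite E] (F : Set E) (hv : v ≠ r) :
    HasEDPaths tail head F r v (lam tail head F r v) :=
  Nat.sSup_mem (s := {n | HasEDPaths tail head F r v n})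
    ⟨0, Fin.elim0, fun i => i.elim0, fun i => i.elim0⟩ (bddAbove_hasEDPaths F hv)

lemma lam_le_rho [Finite E] {X : Set α} (hv : v ∈ X) (hr : r ∉ X) :
    lam tail head F r v ≤ rho tail head F X :=
  (hasEDPaths_lam F (ne_of_mem_of_not_mem hv hr)).le_rho hv hr

lemma lam_le_inDeg [Finite E] (hv : v ≠ r) : lam tail head F r v ≤ inDeg head F v :=
  (lam_le_rho (Set.mem_singleton v) hv.symm).trans (rho_singleton_le_inDeg F v)

lemma le_lam_of_forall_le_rho [Finite α] [Finite E] (hv : v ≠ r) {k : ℕ}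
    (h : ∀ X : Set α, v ∈ X → r ∉ X → k ≤ rho tail head F X) : k ≤ lam tail head F r v :=
  le_csSup (bddAbove_hasEDPaths F hv) (hasEDPaths_of_forall_le_rho hv h)

lemma exists_tight [Finite α] [Finite E] (F : Set E) (hv : v ≠ r) :
    ∃ X, Tight tail head F r v X := by
  by_contra! hX
  refine (Nat.lt_succ_self (lam tail head F r v)).not_ge
    (le_lam_of_forall_le_rho hv fun X hvX hrX => ?_)
  exact (lam_le_rho hvX hrX).lt_of_ne fun heq => hX X ⟨hvX, hrX, heq.symm⟩

/-- If `F ⊆ G` preserves all local edge-connectivities from `r`, then the cut of any vertex set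
in `F` is at least as large as the cut of some larger vertex set in `G`. -/
lemma exists_superset_rho_le [Finite α] [Finite E] (hFG : F ⊆ G)
    (hlam : ∀ v, v ≠ r → lam tail head G r v = lam tail head F r v) {X : Set α} (hr : r ∉ X) :
    ∃ Y, X ⊆ Y ∧ r ∉ Y ∧ rho tail head G Y ≤ rho tail head F X := by
  let S : Set (Set α) := {Y | X ⊆ Y ∧ r ∉ Y ∧ rho tail head F Y ≤ rho tail head F X}
  obtain ⟨Y, hY⟩ := (Set.toFinite S).exists_maximal ⟨X, subset_rfl, hr, le_rfl⟩
  obtain ⟨hXY, hrY, hYX⟩ := hY.prop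
  refine ⟨Y, hXY, hrY, (Set.ncard_le_ncard ?_).trans hYX⟩
  rintro e ⟨heG, het, heh⟩
  refine ⟨?_, het, heh⟩
  have hne : head e ≠ r := ne_of_mem_of_not_mem heh hrY
  obtain ⟨Z, heZ, hrZ, hZ⟩ := exists_tight (tail := tail) (head := head) G hne
  have hZF : rho tail head G Z ≤ rho tail head F Z := by
    rw [hZ, hlam _ hne]
    exact lam_le_rho heZ hrZ
  have hZY : Z ⊆ Y := by
    have h1 := rho_inter_add_rho_union_le (tail := tail) (head := head) F Y Z
    have h2 : lam tail head F r (head e) ≤ rho tail head F (Y ∩ Z) :=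
      lam_le_rho ⟨heh, heZ⟩ fun h => hrY h.1
    have h3 := rho_mono (tail := tail) (head := head) hFG Z
    have h4 := hlam _ hne
    refine Set.subset_union_right.trans (hY.le_of_ge (y := Y ∪ Z) ?_ Set.subset_union_left)
    exact ⟨hXY.trans Set.subset_union_left, fun h => h.elim hrY hrZ, by omega⟩
  have heq : {f ∈ F | tail f ∉ Z ∧ head f ∈ Z} = {f ∈ G | tail f ∉ Z ∧ head f ∈ Z} :=
    Set.eq_of_subset_of_ncard_le (fun f hf => ⟨hFG hf.1, hf.2⟩) hZF
  have hmem : e ∈ {f ∈ G | tail f ∉ Z ∧ head f ∈ Z} := ⟨heG, fun h => het (hZY h), heZ⟩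
  rw [← heq] at hmem
  exact hmem.1

end Cuts

section Sink

variable {α E : Type*} {tail head : E → α} {F G B : Set E} {r v t : α} {p : List E}

/-- In a walk, an edge whose head is a sink is the last edge. -/
lemma getLast?_of_head_eq_sink (hsink : ∀ e : E, tail e ≠ t) {e : E} (he : head e = t) :
    ∀ {p : List E}, List.IsChain (fun e f => head e = tail f) p → e ∈ p → p.getLast? = some e
  | [], _, h => by simp at h
  | [f], _, h => by simpa using (List.mem_singleton.1 h).symm
  | f :: g :: p, hc, h => by
    rw [List.isChain_cons_cons] at hc
    rcases List.mem_cons.1 h with rfl | h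
    · exact absurd (hc.1.symm.trans he) (hsink g)
    · simpa using getLast?_of_head_eq_sink hsink he hc.2 h

lemma IsRVPath.head_ne_sink (hsink : ∀ e : E, tail e ≠ t) (h : IsRVPath tail head F r v p)
    (hv : v ≠ t) {e : E} (he : e ∈ p) : head e ≠ t := by
  intro het
  obtain ⟨-, hc, -, -, -, f, hf, hfv⟩ := h
  rw [getLast?_of_head_eq_sink hsink het hc he, Option.some_inj] at hf
  exact hv (hfv.symm.trans (hf ▸ het))

lemma lam_eq_of_ne_sink (hsink : ∀ e : E, tail e ≠ t) (hv : v ≠ t) (hFG : F ⊆ G)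
    (hGF : ∀ e ∈ G, head e ≠ t → e ∈ F) : lam tail head G r v = lam tail head F r v := by
  have hiff : ∀ p, IsRVPath tail head G r v p ↔ IsRVPath tail head F r v p := fun p =>
    ⟨fun h => h.of_forall_mem fun e he => hGF e (h.1 e he) (h.head_ne_sink hsink hv he),
      fun h => h.of_forall_mem fun e he => hFG (h.1 e he)⟩
  simp only [lam, HasEDPaths, hiff]

lemma inDeg_eq_zero (hF : ∀ e ∈ F, head e ≠ v) : inDeg head F v = 0 := by
  have : {e ∈ F | head e = v} = ∅ := Set.eq_empty_of_forall_notMem fun e he => hF e he.1 he.2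
  rw [inDeg, this, Set.ncard_empty]

lemma lam_eq_zero [Finite E] (hv : v ≠ r) (hF : ∀ e ∈ F, head e ≠ v) :
    lam tail head F r v = 0 :=
  Nat.eq_zero_of_le_zero (inDeg_eq_zero hF ▸ lam_le_inDeg hv)

lemma GammoidIndep.head_eq (h : GammoidIndep tail head r t B) {e : E} (he : e ∈ B) :
    head e = t := by
  obtain ⟨P, hP, -, hB⟩ := h
  obtain ⟨i, hi⟩ := (hB e).1 he
  obtain ⟨-, -, -, -, -, f, hf, hft⟩ := hP i
  rw [hi, Option.some_inj] at hf
  exact hf ▸ hft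

lemma GammoidIndep.hasEDPaths (hsink : ∀ e : E, tail e ≠ t) (h : GammoidIndep tail head r t B) :
    HasEDPaths tail head ({e | tail e ≠ t ∧ head e ≠ t} ∪ B) r t B.ncard := by
  obtain ⟨P, hP, hdisj, hB⟩ := h
  refine ⟨P, fun i => (hP i).of_forall_mem fun e he => ?_, hdisj⟩
  by_cases het : head e = t
  · exact Or.inr ((hB e).2 ⟨i, getLast?_of_head_eq_sink hsink het (hP i).2.1 he⟩)
  · exact Or.inl ⟨hsink e, het⟩

/-- If the in-degree of `t` in `F` equals its edge-connectivity in `F`, then the edges of `F`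
entering `t` are independent in the gammoid. -/
lemma gammoidIndep_of_lam_eq_inDeg [Finite E] (ht : t ≠ r)
    (h : lam tail head F r t = inDeg head F t) :
    GammoidIndep tail head r t {e ∈ F | head e = t} := by
  have hpaths := hasEDPaths_lam (tail := tail) (head := head) F ht
  rw [h] at hpaths
  obtain ⟨P, hP, hdisj⟩ := hpaths
  refine ⟨P, fun i => (hP i).of_forall_mem fun e _ => Set.mem_univ e, hdisj, ?_⟩
  choose l hl hlt using fun i => (hP i).2.2.2.2.2
  have hmem : ∀ i, l i ∈ P i := fun i => List.mem_of_getLast? (hl i)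
  have hinj : Function.Injective l := fun i j hij => by
    by_contra hne
    exact hdisj i j hne (l i) (hmem i) (hij ▸ hmem j)
  have hrange : Set.range l = {e ∈ F | head e = t} := by
    refine Set.eq_of_subset_of_ncard_le ?_ ?_
    · rintro _ ⟨i, rfl⟩
      exact ⟨(hP i).1 _ (hmem i), hlt i⟩
    · rw [← Set.image_univ, Set.ncard_image_of_injective _ hinj, Set.ncard_univ, Nat.card_fin]
      rfl
  intro e
  have he := Set.ext_iff.1 hrange e
  refine he.symm.trans (exists_congr fun i => ?_)
  rw [hl i, Option.some_inj]

/-- A subgraph of `D - t` that preserves all local edge-connectivities from `r` links every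
independent set of the gammoid of the sink `t`. -/
lemma GammoidIndep.ncard_le_lam [Finite α] [Finite E] (ht : t ≠ r) (hsink : ∀ e : E, tail e ≠ t)
    (hF : F ⊆ {e | tail e ≠ t ∧ head e ≠ t})
    (hlam : ∀ v, v ≠ r → lam tail head {e | tail e ≠ t ∧ head e ≠ t} r v = lam tail head F r v)
    (hB : GammoidIndep tail head r t B) : B.ncard ≤ lam tail head (F ∪ B) r t := by
  refine le_lam_of_forall_le_rho ht fun X htX hrX => ?_
  obtain ⟨Y, hXY, hrY, hY⟩ := exists_superset_rho_le hF hlam hrX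
  have hdisj : Disjoint {e ∈ F | tail e ∉ X ∧ head e ∈ X} {e ∈ B | tail e ∉ X} :=
    Set.disjoint_left.2 fun e he he' => (hF he.1).2 (hB.head_eq he'.1)
  calc B.ncard ≤ rho tail head ({e | tail e ≠ t ∧ head e ≠ t} ∪ B) Y :=
        (hB.hasEDPaths hsink).le_rho (hXY htX) hrY
    _ ≤ ({e | (tail e ≠ t ∧ head e ≠ t) ∧ tail e ∉ Y ∧ head e ∈ Y} ∪
          {e ∈ B | tail e ∉ X}).ncard := by
        refine Set.ncard_le_ncard ?_
        rintro e ⟨he | he, heY⟩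
        · exact Or.inl ⟨he, heY⟩
        · exact Or.inr ⟨he, fun h => heY.1 (hXY h)⟩
    _ ≤ rho tail head {e | tail e ≠ t ∧ head e ≠ t} Y + {e ∈ B | tail e ∉ X}.ncard :=
        Set.ncard_union_le _ _
    _ ≤ rho tail head F X + {e ∈ B | tail e ∉ X}.ncard := Nat.add_le_add_right hY _
    _ = ({e ∈ F | tail e ∉ X ∧ head e ∈ X} ∪ {e ∈ B | tail e ∉ X}).ncard :=
        (Set.ncard_union_eq hdisj).symm
    _ ≤ rho tail head (F ∪ B) X := by
        refine Set.ncard_le_ncard ?_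
        rintro e (he | he)
        · exact ⟨Or.inl he.1, he.2⟩
        · exact ⟨Or.inr he.1, he.2, (hB.head_eq he.1).symm ▸ htX⟩

end Sink

/-- if `t ∈ V` is a sink of `D` (no edge leaves `t`), then
`F ⊆ E` is a maximal flame of `D` if and only if `F` is the disjoint union of a
maximal flame of `D − t` and a base of the gammoid `G_D(t)`. -/
theorem maximal_flame_iff_sink_decomposition
    {α E : Type*} [Fintype α] [Fintype E] (tail head : E → α) (r t : α)
    (ht : t ≠ r) (hsink : ∀ e : E, tail e ≠ t) (F : Set E) :
    IsMaxFlameIn tail head Set.univ r F ↔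
      ∃ F₀ B : Set E,
        IsMaxFlameIn tail head {e | tail e ≠ t ∧ head e ≠ t} r F₀ ∧
        GammoidIndep tail head r t B ∧
        B.ncard = lam tail head Set.univ r t ∧
        Disjoint F₀ B ∧ F = F₀ ∪ B := by
  constructor
  · rintro ⟨-, hF⟩
    have hsub : {e ∈ F | head e ≠ t} ⊆ {e | tail e ≠ t ∧ head e ≠ t} :=
      fun e he => ⟨hsink e, he.2⟩
    refine ⟨{e ∈ F | head e ≠ t}, {e ∈ F | head e = t}, ⟨hsub, fun v hv => ?_⟩,
      gammoidIndep_of_lam_eq_inDeg ht (hF t ht).2, ?_, ?_, ?_⟩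
    · by_cases hvt : v = t
      · subst hvt
        rw [lam_eq_zero ht fun e he => he.2, lam_eq_zero ht fun e he => he.2,
          inDeg_eq_zero fun e he => he.2]
        exact ⟨rfl, rfl⟩
      · have hD : lam tail head Set.univ r v =
            lam tail head {e | tail e ≠ t ∧ head e ≠ t} r v :=
          lam_eq_of_ne_sink hsink hvt (Set.subset_univ _) fun e _ he => ⟨hsink e, he⟩
        have hF₀ : lam tail head F r v = lam tail head {e ∈ F | head e ≠ t} r v :=
          lam_eq_of_ne_sink hsink hvt (fun e he => he.1) fun e he he' => ⟨he, he'⟩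
        rw [← hD, ← hF₀, (hF v hv).1]
        refine ⟨rfl, (hF v hv).2.trans ?_⟩
        unfold inDeg
        congr 1
        ext e
        exact ⟨fun he => ⟨⟨he.1, fun h => hvt (he.2.symm.trans h)⟩, he.2⟩,
          fun he => ⟨he.1.1, he.2⟩⟩
    · exact ((hF t ht).1.trans (hF t ht).2).symm
    · exact Set.disjoint_left.2 fun e he he' => he.2 he'.2
    · ext e
      simp only [Set.mem_union, Set.mem_ofPred_eq]
      tauto
  · rintro ⟨F₀, B, ⟨hF₀, hlam⟩, hB, hcard, -, rfl⟩
    refine ⟨Set.subset_univ _, fun v hv => ?_⟩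
    by_cases hvt : v = t
    · subst hvt
      have hdeg : inDeg head (F₀ ∪ B) v = B.ncard := by
        unfold inDeg
        congr 1
        ext e
        refine ⟨fun he => he.1.resolve_left fun h => (hF₀ h).2 he.2, fun he => ⟨Or.inr he, ?_⟩⟩
        exact hB.head_eq he
      have hle := hB.ncard_le_lam ht hsink hF₀ fun v hv => (hlam v hv).1
      have hge := lam_le_inDeg (tail := tail) (head := head) (F := F₀ ∪ B) ht
      omega
    · have hD : lam tail head Set.univ r v =
          lam tail head {e | tail e ≠ t ∧ head e ≠ t} r v :=
        lam_eq_of_ne_sink hsink hvt (Set.subset_univ _) fun e _ he => ⟨hsink e, he⟩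
      have hF : lam tail head (F₀ ∪ B) r v = lam tail head F₀ r v :=
        lam_eq_of_ne_sink hsink hvt Set.subset_union_left
          fun e he he' => he.resolve_right fun h => he' (hB.head_eq h)
      rw [hD, hF]
      refine ⟨(hlam v hv).1, (hlam v hv).2.trans ?_⟩
      unfold inDeg
      congr 1
      ext e
      refine ⟨fun he => ⟨Or.inl he.1, he.2⟩, fun he => ⟨he.1.resolve_right fun h => ?_, he.2⟩⟩
      exact hvt (he.2.symm.trans (hB.head_eq h))
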